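/- arXiv:1504.07618 — 3 statements merged into one kernel-verified Lean document; each statement's English description precedes it below -/
import Mathlib

section
/- Let ℓ > 7 be prime. A subgroup G of GL₂(ℤ/ℓℤ) contains SL₂(ℤ/ℓℤ) if and only if G contains elements g₁, g₂, g₃, each of nonzero trace, such that: (1) tr(g₁)² − 4·det(g₁) is a nonzero square in ℤ/ℓℤ; (2) tr(g₂)² − 4·det(g₂) is a non-square in ℤ/ℓℤ; and (3) setting u := tr(g₃)²·det(g₃)⁻¹ ∈ ℤ/ℓℤ, one has u ∉ {1, 2, 4} and u² − 3u + 1 ≠ 0. -/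
open Matrix

/-- `GL₂(ℤ/ℓℤ)`. -/
abbrev GL2 (ℓ : ℕ) := GL (Fin 2) (ZMod ℓ)

/-- The underlying matrix of an element of `GL₂(ℤ/ℓℤ)`. -/
def mat {ℓ : ℕ} (g : GL2 ℓ) : Matrix (Fin 2) (Fin 2) (ZMod ℓ) := g

theorem card_le_two_of_sum_sub_eq {Ω : Type*} [Fintype Ω] (n : Ω → ℕ) (N : ℕ) (hN : 0 < N)
    (hd : ∀ ω, n ω ∣ N) (hsum : ∑ ω, ((N : ℤ) - n ω) = 2 * N - 2)
    (a : Ω) (ha : 6 * n a ≤ N) : n a ≤ 2 := by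
  classical
  by_contra! hlt
  have hcase : ∀ ω, n ω = N ∨ 2 * n ω = N ∨ 3 * n ω ≤ N := by
    intro ω
    obtain ⟨k, hk⟩ := hd ω
    rcases k with _ | _ | _ | k
    · omega
    · left; omega
    · right; left; omega
    · right; right; rw [hk]; nlinarith
  have hsub : ∀ s : Finset Ω, ∑ ω ∈ s, ((N : ℤ) - n ω) ≤ 2 * N - 2 := by
    intro s
    rw [← hsum]
    refine Finset.sum_le_univ_sum_of_nonneg fun ω => ?_
    have := hcase ω
    omega
  have hex : ∀ s : Finset Ω, ∑ ω ∈ s, ((N : ℤ) - n ω) ≠ 2 * N - 2 → ∃ ω ∉ s, n ω ≠ N := by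
    intro s hs
    by_contra! h
    apply hs
    rw [← hsum]
    refine Finset.sum_subset (Finset.subset_univ s) fun ω _ hω => ?_
    rw [h ω hω, sub_self]
  obtain ⟨b, hb, hbN⟩ := hex {a} (by rw [Finset.sum_singleton]; omega)
  obtain ⟨c, hc, hcN⟩ := hex {b, a} (by rw [Finset.sum_insert hb, Finset.sum_singleton]; omega)
  have h₃ : ∑ ω ∈ {c, b, a}, ((N : ℤ) - n ω) = (N - n c) + ((N - n b) + (N - n a)) := by
    rw [Finset.sum_insert hc, Finset.sum_insert hb, Finset.sum_singleton]
  have hcb := hcase b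
  have hcc := hcase c
  by_cases h : ∑ ω ∈ {c, b, a}, ((N : ℤ) - n ω) = 2 * N - 2
  · omega
  · obtain ⟨d, hd', hdN⟩ := hex _ h
    have h₄ := hsub (insert d {c, b, a})
    rw [Finset.sum_insert hd', h₃] at h₄
    have hcd := hcase d
    omega

open MulAction in
theorem exists_fixed_sq_or_pow_eq_one {H X : Type*} [Group H] [Finite H] [Finite X] [MulAction H X]
    (hfix : ∀ g : H, g ≠ 1 → Nat.card (fixedBy X g) = 2) :
    (∃ x : X, ∀ g : H, g • g • x = x) ∨ ∀ g : H, ∃ n, 1 ≤ n ∧ n ≤ 5 ∧ g ^ n = 1 := by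
  classical
  have := Fintype.ofFinite H
  have := Fintype.ofFinite X
  have := Fintype.ofFinite (orbitRel.Quotient H X)
  refine or_iff_not_imp_right.mpr fun hpow => ?_
  push Not at hpow
  obtain ⟨h, hh⟩ := hpow
  have hcard : ∀ ω : orbitRel.Quotient H X,
      Nat.card (orbit H ω.out) * Nat.card (stabilizer H ω.out) = Nat.card H := by
    intro ω
    simp only [Nat.card_eq_fintype_card]
    exact card_orbit_mul_card_stabilizer_eq_card_group H ω.out
  have hsumX : Nat.card X = ∑ ω : orbitRel.Quotient H X, Nat.card (orbit H ω.out) := by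
    rw [Nat.card_congr (selfEquivSigmaOrbits H X), Nat.card_sigma]
  have hfixsum : ∑ g : H, Nat.card (fixedBy X g) = Nat.card X + 2 * (Nat.card H - 1) := by
    rw [← Finset.add_sum_erase _ _ (Finset.mem_univ (1 : H))]
    congr 1
    · exact Nat.card_congr (Equiv.subtypeUnivEquiv fun x => one_smul H x)
    · rw [Finset.sum_congr rfl fun g hg => hfix g (Finset.ne_of_mem_erase hg), Finset.sum_const,
        Finset.card_erase_of_mem (Finset.mem_univ _), Finset.card_univ, smul_eq_mul, mul_comm,
        Nat.card_eq_fintype_card]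
  have hburnside := sum_card_fixedBy_eq_card_orbits_mul_card_group H X
  simp only [← Nat.card_eq_fintype_card] at hburnside
  rw [hfixsum, hsumX] at hburnside
  have hHpos : 0 < Nat.card H := Nat.card_pos
  have hsum : ∑ ω : orbitRel.Quotient H X,
      ((Nat.card H : ℤ) - (Nat.card (orbit H ω.out) : ℕ)) = 2 * Nat.card H - 2 := by
    rw [Finset.sum_sub_distrib, Finset.sum_const, Finset.card_univ, ← Nat.card_eq_fintype_card,
      nsmul_eq_mul]
    zify [Nat.one_le_iff_ne_zero.mpr hHpos.ne'] at hburnside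
    linarith
  have h1 : h ≠ 1 := fun h1 => hh 1 le_rfl (by norm_num) (by rw [h1, one_pow])
  have hord : 6 ≤ orderOf h := by
    by_contra! hlt
    exact hh _ (orderOf_pos h) (by omega) (pow_orderOf_eq_one h)
  have : Nonempty (fixedBy X h) := (Nat.card_pos_iff.mp (by rw [hfix h h1]; norm_num)).1
  obtain ⟨y, hy⟩ := this
  have hy_mem : y ∈ orbit H (Quotient.mk'' y : orbitRel.Quotient H X).out := by
    rw [← orbitRel_apply]
    exact (orbitRel H X).symm (Quotient.mk_out (s := orbitRel H X) y)
  set ω : orbitRel.Quotient H X := Quotient.mk'' y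
  have horb : orbit H ω.out = orbit H y := (orbit_eq_iff.mpr hy_mem).symm
  have hstab : 6 ≤ Nat.card (stabilizer H y) := by
    have hle : Subgroup.zpowers h ≤ stabilizer H y := by
      rw [Subgroup.zpowers_le]; exact hy
    have := Subgroup.card_le_of_le hle
    rw [Nat.card_zpowers] at this
    omega
  have hcy : Nat.card (orbit H y) * Nat.card (stabilizer H y) = Nat.card H := by
    simp only [Nat.card_eq_fintype_card]
    exact card_orbit_mul_card_stabilizer_eq_card_group H y
  have hle2 := card_le_two_of_sum_sub_eq (fun ω : orbitRel.Quotient H X => Nat.card (orbit H ω.out))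
    _ hHpos (fun ω => ⟨_, (hcard ω).symm⟩) hsum ω (by
      rw [horb, ← hcy]; nlinarith)
  change Nat.card (orbit H ω.out) ≤ 2 at hle2
  rw [horb] at hle2
  refine ⟨y, fun g => ?_⟩
  by_contra hne
  have hne₁ : g • y ≠ y := fun e => hne (by rw [e, e])
  have hne₂ : g • g • y ≠ g • y := fun e => hne₁ (smul_left_cancel g e)
  have hsubset : ({y, g • y, g • g • y} : Set X) ⊆ orbit H y := by
    rintro z (rfl | rfl | rfl)
    · exact mem_orbit_self _
    · exact mem_orbit _ _
    · exact ⟨g * g, mul_smul g g y⟩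
  have hcard3 : ({y, g • y, g • g • y} : Set X).ncard = 3 := by
    rw [Set.ncard_eq_three]
    exact ⟨_, _, _, hne₁.symm, Ne.symm hne, hne₂.symm, rfl⟩
  have := Set.ncard_le_ncard hsubset (Set.toFinite _)
  rw [hcard3, ← Nat.card_coe_set_eq] at this
  omega

section Transvections

variable {F : Type*} [Field F]

theorem mem_of_det_eq_one_of_transvections (G : Subgroup (GL (Fin 2) F))
    (hU : ∀ (g : GL (Fin 2) F) (x : F), g.val = !![1, x; 0, 1] → g ∈ G)
    (hL : ∀ (g : GL (Fin 2) F) (x : F), g.val = !![1, 0; x, 1] → g ∈ G)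
    (g : GL (Fin 2) F) (hg : g.val.det = 1) : g ∈ G := by
  let U (x : F) : GL (Fin 2) F := GeneralLinearGroup.mkOfDetNeZero !![1, x; 0, 1] (by simp)
  let L (x : F) : GL (Fin 2) F := GeneralLinearGroup.mkOfDetNeZero !![1, 0; x, 1] (by simp)
  have hU' (x : F) : U x ∈ G := hU _ x rfl
  have hL' (x : F) : L x ∈ G := hL _ x rfl
  have main (g : GL (Fin 2) F) (hg : g.val.det = 1) (hc : g.val 1 0 ≠ 0) : g ∈ G := by
    have : g = U ((g.val 0 0 - 1) / g.val 1 0) * L (g.val 1 0) *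
        U ((g.val 1 1 - 1) / g.val 1 0) := by
      rw [det_fin_two] at hg
      refine Units.ext (Matrix.ext fun i j => ?_)
      change _ = ((!![1, (g.val 0 0 - 1) / g.val 1 0; 0, 1] * !![1, 0; g.val 1 0, 1] *
        !![1, (g.val 1 1 - 1) / g.val 1 0; 0, 1] : Matrix (Fin 2) (Fin 2) F)) i j
      fin_cases i <;> fin_cases j <;> simp [mul_apply, Fin.sum_univ_two] <;> field_simp <;>
        first | ring1 | linear_combination -hg
    rw [this]
    exact G.mul_mem (G.mul_mem (hU' _) (hL' _)) (hU' _)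
  by_cases hc : g.val 1 0 = 0
  · have hdet : g.val 0 0 ≠ 0 := by
      intro h0
      rw [det_fin_two, h0, hc] at hg
      simp at hg
    have : L 1 * g ∈ G := by
      have hval : (L 1 * g).val = !![1, 0; 1, 1] * g.val := rfl
      refine main _ (by rw [hval, det_mul, hg]; simp) ?_
      rw [hval]
      simpa [mul_apply, Fin.sum_univ_two, hc] using hdet
    exact (G.mul_mem_cancel_left (hL' 1)).mp this
  · exact main g hg hc

end Transvections

section Prime

variable {ℓ : ℕ} [Fact ℓ.Prime]

theorem upper_pow_succ {F : Type*} [Field F] (a m : F) (k : ℕ) :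
    (!![a, m; 0, a] ^ (k + 1) : Matrix (Fin 2) (Fin 2) F) =
      !![a ^ (k + 1), (k + 1) * a ^ k * m; 0, a ^ (k + 1)] := by
  induction k with
  | zero => simp
  | succ k ih =>
    rw [pow_succ, ih]
    ext i j
    fin_cases i <;> fin_cases j <;> simp [mul_apply, Fin.sum_univ_two] <;> ring

theorem upper_unipotent_mem (G : Subgroup (GL (Fin 2) (ZMod ℓ))) (u : GL (Fin 2) (ZMod ℓ))
    (hu : u ∈ G) (x : ZMod ℓ) (hx : x ≠ 0) (hux : u.val = !![1, x; 0, 1])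
    (g : GL (Fin 2) (ZMod ℓ)) (y : ZMod ℓ) (hg : g.val = !![1, y; 0, 1]) : g ∈ G := by
  suffices g = u ^ ((y / x - 1).val + 1) from this ▸ G.pow_mem hu _
  refine Units.ext ?_
  rw [Units.val_pow_eq_pow_val, hux, upper_pow_succ, hg, ZMod.natCast_zmod_val]
  simp [hx]

theorem mem_of_det_eq_one_of_upper_of_swap (G : Subgroup (GL (Fin 2) (ZMod ℓ)))
    (g h : GL (Fin 2) (ZMod ℓ)) (hg : g ∈ G) (hh : h ∈ G) (a m b d : ZMod ℓ) (hm : m ≠ 0)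
    (hga : g.val = !![a, m; 0, a]) (hhb : h.val = !![0, b; 1, d])
    (k : GL (Fin 2) (ZMod ℓ)) (hk : k.val.det = 1) : k ∈ G := by
  have hp := (Fact.out : ℓ.Prime).two_le
  have ha : a ≠ 0 := by
    have := g.det_ne_zero
    rw [hga, det_fin_two] at this
    rintro rfl
    simp at this
  have hb : b ≠ 0 := by
    have := h.det_ne_zero
    rw [hhb, det_fin_two] at this
    rintro rfl
    simp at this
  have hU : ∀ (g : GL (Fin 2) (ZMod ℓ)) (x : ZMod ℓ), g.val = !![1, x; 0, 1] → g ∈ G := by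
    refine upper_unipotent_mem G (g ^ (ℓ - 2 + 1)) (G.pow_mem hg _) (-(a ^ (ℓ - 2) * m))
      (neg_ne_zero.mpr (mul_ne_zero (pow_ne_zero _ ha) hm)) ?_
    rw [Units.val_pow_eq_pow_val, hga, upper_pow_succ]
    have h1 : a ^ (ℓ - 2 + 1) = 1 := by
      rw [show ℓ - 2 + 1 = ℓ - 1 by omega]
      exact ZMod.pow_card_sub_one_eq_one ha
    have h2 : ((ℓ - 2 : ℕ) : ZMod ℓ) + 1 = -1 := by
      rw [Nat.cast_sub hp, ZMod.natCast_self]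
      norm_num
    rw [h1, h2]
    congr 3
    ring_nf
  refine mem_of_det_eq_one_of_transvections G hU (fun l y hl => ?_) k hk
  have hmem : h⁻¹ * l * h ∈ G := by
    let u : GL (Fin 2) (ZMod ℓ) := GeneralLinearGroup.mkOfDetNeZero !![1, y * b; 0, 1] (by simp)
    have hu : u ∈ G := hU u _ rfl
    suffices h⁻¹ * l * h = u by rwa [this]
    rw [mul_assoc, inv_mul_eq_iff_eq_mul]
    refine Units.ext ?_
    change l.val * h.val = h.val * !![1, y * b; 0, 1]
    rw [hl, hhb]
    ext i j
    fin_cases i <;> fin_cases j <;> simp [mul_apply, Fin.sum_univ_two]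
  have := G.mul_mem (G.mul_mem hh hmem) (G.inv_mem hh)
  simpa [mul_assoc] using this

/-- A matrix is scalar when its off-diagonal entries vanish and its diagonal entries agree. -/
def IsScalarMat {R : Type*} [CommRing R] (M : Matrix (Fin 2) (Fin 2) R) : Prop :=
  M 0 1 = 0 ∧ M 1 0 = 0 ∧ M 0 0 = M 1 1

theorem mem_of_det_eq_one_of_nonscalar_of_nonsquare (h2 : (2 : ZMod ℓ) ≠ 0)
    (G : Subgroup (GL (Fin 2) (ZMod ℓ)))
    (g h : GL (Fin 2) (ZMod ℓ)) (hg : g ∈ G) (hh : h ∈ G) (hgs : ¬ IsScalarMat g.val)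
    (hgd : g.val.trace ^ 2 - 4 * g.val.det = 0)
    (hhd : ¬ IsSquare (h.val.trace ^ 2 - 4 * h.val.det))
    (k : GL (Fin 2) (ZMod ℓ)) (hk : k.val.det = 1) : k ∈ G := by
  obtain ⟨v, hv0, hv⟩ : ∃ v ≠ 0, (g.val - (g.val.trace / 2) • 1) *ᵥ v = 0 := by
    rw [exists_mulVec_eq_zero_iff]
    simp only [det_fin_two, trace_fin_two] at hgd ⊢
    simp
    field_simp
    linear_combination -hgd
  have hv₀ := congrFun hv 0
  have hv₁ := congrFun hv 1
  simp [mulVec, dotProduct, Fin.sum_univ_two] at hv₀ hv₁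
  have hQ : (!![v 0, h.val 0 0 * v 0 + h.val 0 1 * v 1;
      v 1, h.val 1 0 * v 0 + h.val 1 1 * v 1]).det ≠ 0 := by
    intro hQ
    simp [det_fin_two] at hQ
    apply hhd
    rw [det_fin_two, trace_fin_two]
    by_cases h1 : v 1 = 0
    · have h0 : v 0 ≠ 0 := by
        intro h0
        apply hv0
        ext i
        fin_cases i <;> assumption
      have hc : h.val 1 0 = 0 := by simpa [h1, h0] using hQ
      exact ⟨h.val 0 0 - h.val 1 1, by rw [hc]; ring⟩
    · refine ⟨2 * h.val 1 0 * v 0 / v 1 + h.val 1 1 - h.val 0 0, ?_⟩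
      field_simp
      linear_combination -4 * h.val 1 0 * hQ
  set P : GL (Fin 2) (ZMod ℓ) := GeneralLinearGroup.mkOfDetNeZero _ hQ
  have hPv : P.val = !![v 0, h.val 0 0 * v 0 + h.val 0 1 * v 1;
      v 1, h.val 1 0 * v 0 + h.val 1 1 * v 1] := rfl
  have hdet := hQ
  rw [det_fin_two_of] at hdet
  have hmem (x : GL (Fin 2) (ZMod ℓ)) :
      P⁻¹ * x * P ∈ G.comap (MulAut.conj P).toMonoidHom ↔ x ∈ G := by
    simp [Subgroup.mem_comap, MulAut.conj_apply, mul_assoc]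
  have hPg : P.val * (P⁻¹ * g * P).val = g.val * P.val := by
    rw [← Units.val_mul, ← Units.val_mul]; simp [mul_assoc]
  have hPh : P.val * (P⁻¹ * h * P).val = h.val * P.val := by
    rw [← Units.val_mul, ← Units.val_mul]; simp [mul_assoc]
  have hdg : (P⁻¹ * g * P).val.det = g.val.det := by
    have := congrArg det hPg
    rw [det_mul, det_mul, mul_comm] at this
    exact mul_right_cancel₀ P.det_ne_zero this
  have htg : (P⁻¹ * g * P).val.trace = g.val.trace := by
    rw [Units.val_mul, trace_mul_comm, ← Units.val_mul]; simp
  rw [← hdg, ← htg] at hgd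
  have hg' := (hmem g).mpr hg
  have hh' := (hmem h).mpr hh
  have hgs' : ¬ IsScalarMat (P⁻¹ * g * P).val := by
    rintro ⟨e1, e2, e3⟩
    apply hgs
    have hsc : (P⁻¹ * g * P).val = scalar (Fin 2) ((P⁻¹ * g * P).val 1 1) := by
      ext i j
      fin_cases i <;> fin_cases j <;> simp [e1, e2, e3]
    have : g.val = (P⁻¹ * g * P).val := by
      have h3 : P.val * (P⁻¹ * g * P).val = (P⁻¹ * g * P).val * P.val := by
        rw [hsc]; exact ((scalar_commute _ (fun r => Commute.all _ r) P.val).eq).symm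
      rw [hPg, ← Units.val_mul, ← Units.val_mul] at h3
      exact congrArg Units.val (mul_right_cancel (Units.ext h3))
    rw [this]
    exact ⟨e1, e2, e3⟩
  generalize P⁻¹ * g * P = g' at *
  generalize P⁻¹ * h * P = h' at *
  rw [hPv] at hPg hPh
  have hPg₀ := congrFun (congrFun hPg 0) 0
  have hPg₁ := congrFun (congrFun hPg 1) 0
  have hPh₀ := congrFun (congrFun hPh 0) 0
  have hPh₁ := congrFun (congrFun hPh 1) 0
  simp [mul_apply, Fin.sum_univ_two] at hPg₀ hPg₁ hPh₀ hPh₁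
  have e10 : g'.val 1 0 = 0 := by
    refine (mul_eq_zero.mp ?_).resolve_left hdet
    linear_combination v 0 * hPg₁ - v 1 * hPg₀ + v 0 * hv₁ - v 1 * hv₀
  have e11 : g'.val 0 0 = g'.val 1 1 := by
    rw [det_fin_two, trace_fin_two, e10] at hgd
    refine sub_eq_zero.mp (pow_eq_zero_iff two_ne_zero |>.mp ?_)
    linear_combination hgd
  have f00 : h'.val 0 0 = 0 := by
    refine (mul_eq_zero.mp ?_).resolve_left hdet
    linear_combination (h.val 1 0 * v 0 + h.val 1 1 * v 1) * hPh₀ -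
      (h.val 0 0 * v 0 + h.val 0 1 * v 1) * hPh₁
  have f10 : h'.val 1 0 = 1 := by
    refine sub_eq_zero.mp ((mul_eq_zero.mp ?_).resolve_left hdet)
    linear_combination v 0 * hPh₁ - v 1 * hPh₀
  have := mem_of_det_eq_one_of_upper_of_swap (G.comap (MulAut.conj P).toMonoidHom) g' h' hg' hh'
    (g'.val 1 1) (g'.val 0 1) (h'.val 0 1) (h'.val 1 1) (fun e => hgs' ⟨e, e10, e11⟩)
    (by ext i j; fin_cases i <;> fin_cases j <;> simp [e10, e11])
    (by ext i j; fin_cases i <;> fin_cases j <;> simp [f00, f10])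
    (P⁻¹ * k * P) (by
      rw [Units.val_mul, det_mul, mul_comm, ← det_mul, ← Units.val_mul]; simpa using hk)
  exact (hmem k).mp this

end Prime

section Mobius

variable {K : Type*} [Field K] [DecidableEq K]

theorem smul_coe_eq_self_iff (g : GL (Fin 2) K) (x : K) :
    g • (x : OnePoint K) = x ↔
      g.val 1 0 * x ^ 2 + (g.val 1 1 - g.val 0 0) * x - g.val 0 1 = 0 := by
  rw [← GeneralLinearGroup.fixpointPolynomial_aeval_eq_zero_iff,
    GeneralLinearGroup.fixpointPolynomial]
  simp

theorem smul_infty_eq_self_iff' (g : GL (Fin 2) K) :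
    g • (OnePoint.infty : OnePoint K) = OnePoint.infty ↔ g.val 1 0 = 0 :=
  OnePoint.smul_infty_eq_self_iff

theorem isScalarMat_iff_forall_smul_eq_self (g : GL (Fin 2) K) :
    IsScalarMat g.val ↔ ∀ x : OnePoint K, g • x = x := by
  constructor
  · rintro ⟨h01, h10, h⟩ x
    cases x with
    | infty => rwa [smul_infty_eq_self_iff']
    | coe x => rw [smul_coe_eq_self_iff, h01, h10, h]; ring
  · intro h
    have h10 := (smul_infty_eq_self_iff' g).mp (h _)
    have h0 := (smul_coe_eq_self_iff g 0).mp (h _)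
    have h1 := (smul_coe_eq_self_iff g 1).mp (h _)
    refine ⟨by linear_combination -h0, h10, by linear_combination h0 - h1 + h10⟩

theorem card_fixedBy_onePoint (h2 : (2 : K) ≠ 0) (g : GL (Fin 2) K)
    (hsq : IsSquare (g.val.trace ^ 2 - 4 * g.val.det)) (h0 : g.val.trace ^ 2 - 4 * g.val.det ≠ 0) :
    Nat.card (MulAction.fixedBy (OnePoint K) g) = 2 := by
  obtain ⟨s, hs⟩ := hsq
  have hs0 : s ≠ 0 := by
    rintro rfl
    exact h0 (by simpa using hs)
  rw [det_fin_two, trace_fin_two] at hs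
  rw [Nat.card_coe_set_eq, Set.ncard_eq_two]
  by_cases hc : g.val 1 0 = 0
  · have had : g.val 1 1 - g.val 0 0 ≠ 0 := by
      intro had
      rw [hc] at hs
      refine mul_ne_zero hs0 hs0 ?_
      linear_combination (g.val 1 1 - g.val 0 0) * had - hs
    refine ⟨OnePoint.infty, ((g.val 0 1 / (g.val 1 1 - g.val 0 0) : K) : OnePoint K),
      OnePoint.infty_ne_coe _, Set.ext fun x => ?_⟩
    rw [MulAction.mem_fixedBy]
    cases x with
    | infty => simp [smul_infty_eq_self_iff', hc]
    | coe x =>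
      rw [smul_coe_eq_self_iff, hc]
      simp only [Set.mem_insert_iff, OnePoint.coe_ne_infty, Set.mem_singleton_iff,
        OnePoint.coe_eq_coe, false_or, eq_div_iff had]
      constructor <;> intro h <;> linear_combination h
  · refine ⟨(((g.val 0 0 - g.val 1 1 + s) / (2 * g.val 1 0) : K) : OnePoint K),
      (((g.val 0 0 - g.val 1 1 - s) / (2 * g.val 1 0) : K) : OnePoint K), ?_, Set.ext fun x => ?_⟩
    · rw [Ne, OnePoint.coe_eq_coe, div_left_inj' (mul_ne_zero h2 hc)]
      intro h
      exact mul_ne_zero h2 hs0 (by linear_combination h)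
    · rw [MulAction.mem_fixedBy]
      cases x with
      | infty => simp [smul_infty_eq_self_iff', hc]
      | coe x =>
        rw [smul_coe_eq_self_iff]
        simp only [Set.mem_insert_iff, Set.mem_singleton_iff, OnePoint.coe_eq_coe,
          eq_div_iff (mul_ne_zero h2 hc)]
        rw [← sub_eq_zero (a := x * (2 * g.val 1 0)) (b := g.val 0 0 - g.val 1 1 + s),
          ← sub_eq_zero (a := x * (2 * g.val 1 0)) (b := g.val 0 0 - g.val 1 1 - s), ← mul_eq_zero]
        have h4 : 4 * g.val 1 0 ≠ 0 := by
          rw [show (4 : K) = 2 * 2 by norm_num]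
          exact mul_ne_zero (mul_ne_zero h2 h2) hc
        rw [← mul_right_inj' h4, mul_zero]
        constructor <;> intro h
        · linear_combination h + hs
        · linear_combination h - hs

end Mobius

section Powers

theorem sq_entries {R : Type*} [CommRing R] (M : Matrix (Fin 2) (Fin 2) R) :
    (M * M) 0 1 = M.trace * M 0 1 ∧ (M * M) 1 0 = M.trace * M 1 0 ∧
      (M * M) 1 1 - (M * M) 0 0 = M.trace * (M 1 1 - M 0 0) := by
  simp only [mul_apply, Fin.sum_univ_two, trace_fin_two]
  refine ⟨?_, ?_, ?_⟩ <;> ring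

variable {F : Type*} [Field F]

theorem eq_zero_of_isScalarMat_smul_sub {M : Matrix (Fin 2) (Fin 2) F} (hM : ¬ IsScalarMat M)
    (p q : F) (h : IsScalarMat (p • M - q • (1 : Matrix (Fin 2) (Fin 2) F))) : p = 0 := by
  by_contra hp
  obtain ⟨h₁, h₂, h₃⟩ := h
  simp [hp] at h₁ h₂ h₃
  exact hM ⟨h₁, h₂, h₃⟩

theorem trace_det_of_pow_isScalarMat {M : Matrix (Fin 2) (Fin 2) F} (hM : ¬ IsScalarMat M)
    (n : ℕ) (h1 : 1 ≤ n) (h5 : n ≤ 5) (hn : IsScalarMat (M ^ n)) :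
    M.trace * (M.trace ^ 2 - M.det) * (M.trace ^ 2 - 2 * M.det) *
      (M.trace ^ 4 - 3 * M.trace ^ 2 * M.det + M.det ^ 2) = 0 := by
  have h₂ : M ^ 2 = M.trace • M - M.det • (1 : Matrix (Fin 2) (Fin 2) F) := by
    ext i j
    fin_cases i <;> fin_cases j <;>
      simp [pow_two, mul_apply, Fin.sum_univ_two, trace_fin_two, det_fin_two] <;> ring
  generalize M.trace = t at *
  generalize M.det = d at *
  have hstep : ∀ (k : ℕ) (p q : F), M ^ k = p • M - q • (1 : Matrix (Fin 2) (Fin 2) F) →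
      M ^ (k + 1) = (p * t - q) • M - (p * d) • (1 : Matrix (Fin 2) (Fin 2) F) := by
    intro k p q hk
    rw [pow_succ, hk, sub_mul, smul_mul_assoc, ← pow_two, h₂, smul_mul_assoc, one_mul]
    module
  have h₃ := hstep _ _ _ h₂
  have h₄ := hstep _ _ _ h₃
  have h₅ := hstep _ _ _ h₄
  interval_cases n
  · exact absurd (by simpa using hn) hM
  · rw [h₂] at hn
    rw [eq_zero_of_isScalarMat_smul_sub hM _ _ hn]; ring
  · rw [h₃] at hn
    have := eq_zero_of_isScalarMat_smul_sub hM _ _ hn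
    linear_combination t * (t ^ 2 - 2 * d) * (t ^ 4 - 3 * t ^ 2 * d + d ^ 2) * this
  · rw [h₄] at hn
    have := eq_zero_of_isScalarMat_smul_sub hM _ _ hn
    linear_combination (t ^ 2 - d) * (t ^ 4 - 3 * t ^ 2 * d + d ^ 2) * this
  · rw [h₅] at hn
    have := eq_zero_of_isScalarMat_smul_sub hM _ _ hn
    linear_combination t * (t ^ 2 - d) * (t ^ 2 - 2 * d) * this

theorem not_isScalarMat_of_disc_ne_zero {M : Matrix (Fin 2) (Fin 2) F}
    (h : M.trace ^ 2 - 4 * M.det ≠ 0) : ¬ IsScalarMat M := by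
  rintro ⟨h₁, h₂, h₃⟩
  apply h
  rw [trace_fin_two, det_fin_two, h₁, h₂, h₃]
  ring

end Powers

theorem isSquare_algebraMap_galoisField_two {ℓ : ℕ} [Fact ℓ.Prime] (h2 : ℓ ≠ 2) (a : ZMod ℓ) :
    IsSquare (algebraMap (ZMod ℓ) (GaloisField ℓ 2) a) := by
  have := Fintype.ofFinite (GaloisField ℓ 2)
  by_cases ha : a = 0
  · simp [ha]
  have hp := (Fact.out : ℓ.Prime)
  have hcard : Fintype.card (GaloisField ℓ 2) = ℓ ^ 2 := by
    rw [← Nat.card_eq_fintype_card, GaloisField.card ℓ 2 two_ne_zero]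
  rw [FiniteField.isSquare_iff (by rwa [ringChar.eq (GaloisField ℓ 2) ℓ]) (by simpa using ha),
    hcard, ← map_pow]
  obtain ⟨k, hk⟩ := hp.odd_of_ne_two h2
  have : ℓ ^ 2 / 2 = (ℓ - 1) * (k + 1) := by
    rw [hk, show (2 * k + 1) ^ 2 = 2 * (2 * k * (k + 1)) + 1 by ring]
    simp only [Nat.add_sub_cancel]
    omega
  rw [this, pow_mul, ZMod.pow_card_sub_one_eq_one ha, one_pow, map_one]

section Main

variable {ℓ : ℕ} [Fact ℓ.Prime]

theorem two_ne_zero_galoisField (h2 : ℓ ≠ 2) : (2 : GaloisField ℓ 2) ≠ 0 :=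
  Ring.two_ne_zero (by rwa [ringChar.eq (GaloisField ℓ 2) ℓ])

open scoped Classical in
theorem exists_nonscalar_disc_eq_zero (h2 : ℓ ≠ 2) (G : Subgroup (GL (Fin 2) (ZMod ℓ)))
    (g₁ g₂ g₃ : GL (Fin 2) (ZMod ℓ)) (hg₁ : g₁ ∈ G) (hg₂ : g₂ ∈ G) (hg₃ : g₃ ∈ G)
    (ht₁ : g₁.val.trace ≠ 0) (hs₁ : IsSquare (g₁.val.trace ^ 2 - 4 * g₁.val.det))
    (hd₁ : g₁.val.trace ^ 2 - 4 * g₁.val.det ≠ 0)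
    (ht₂ : g₂.val.trace ≠ 0) (hs₂ : ¬ IsSquare (g₂.val.trace ^ 2 - 4 * g₂.val.det))
    (hd₃ : g₃.val.trace ^ 2 - 4 * g₃.val.det ≠ 0)
    (hu₃ : g₃.val.trace * (g₃.val.trace ^ 2 - g₃.val.det) * (g₃.val.trace ^ 2 - 2 * g₃.val.det) *
      (g₃.val.trace ^ 4 - 3 * g₃.val.trace ^ 2 * g₃.val.det + g₃.val.det ^ 2) ≠ 0) :
    ∃ g ∈ G, ¬ IsScalarMat g.val ∧ g.val.trace ^ 2 - 4 * g.val.det = 0 := by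
  by_contra! hG
  let f := algebraMap (ZMod ℓ) (GaloisField ℓ 2)
  have hf : Function.Injective f := f.injective
  let φ : GL (Fin 2) (ZMod ℓ) →* GL (Fin 2) (GaloisField ℓ 2) := GeneralLinearGroup.map f
  have hφ (g : GL (Fin 2) (ZMod ℓ)) (i j : Fin 2) : (φ g).val i j = f (g.val i j) := rfl
  let ρ := MulAction.toPermHom (GL (Fin 2) (GaloisField ℓ 2)) (OnePoint (GaloisField ℓ 2))
  have hρ (g : GL (Fin 2) (GaloisField ℓ 2)) (x : OnePoint (GaloisField ℓ 2)) : ρ g x = g • x := rfl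
  have hscal (g : GL (Fin 2) (ZMod ℓ)) : IsScalarMat g.val ↔ ρ (φ g) = 1 := by
    rw [Equiv.ext_iff]
    simp only [hρ, Equiv.Perm.coe_one, id_eq]
    rw [← isScalarMat_iff_forall_smul_eq_self]
    simp only [IsScalarMat, hφ, map_eq_zero, hf.eq_iff]
  have hdisc (g : GL (Fin 2) (ZMod ℓ)) : (φ g).val.trace ^ 2 - 4 * (φ g).val.det =
      f (g.val.trace ^ 2 - 4 * g.val.det) := by
    simp only [trace_fin_two, det_fin_two, hφ, map_sub, map_mul, map_add, map_pow, map_ofNat]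
  have : Finite (OnePoint (GaloisField ℓ 2)) := inferInstanceAs (Finite (Option _))
  have hfix : ∀ p : (G.map φ).map ρ, p ≠ 1 →
      Nat.card (MulAction.fixedBy (OnePoint (GaloisField ℓ 2)) p) = 2 := by
    rintro ⟨_, _, ⟨g, hg, rfl⟩, rfl⟩ hp
    have hns : ¬ IsScalarMat g.val := by
      rw [hscal]
      exact fun h => hp (Subtype.ext h)
    refine card_fixedBy_onePoint (two_ne_zero_galoisField h2) (φ g) ?_ ?_
    · rw [hdisc]; exact isSquare_algebraMap_galoisField_two h2 _
    · rw [hdisc, map_ne_zero]; exact hG g hg hns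
  rcases exists_fixed_sq_or_pow_eq_one hfix with ⟨x, hx⟩ | hpow
  · have key (g : GL (Fin 2) (ZMod ℓ)) (hg : g ∈ G) : φ (g * g) • x = x := by
      have := hx ⟨ρ (φ g), Subgroup.mem_map_of_mem _ (Subgroup.mem_map_of_mem _ hg)⟩
      rw [map_mul, mul_smul]
      exact this
    have key₁ := key g₁ hg₁
    have key₂ := key g₂ hg₂
    have hval (g : GL (Fin 2) (ZMod ℓ)) : (g * g).val = g.val * g.val := rfl
    obtain ⟨a01, a10, a11⟩ := sq_entries g₁.val
    obtain ⟨b01, b10, b11⟩ := sq_entries g₂.val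
    rw [det_fin_two, trace_fin_two] at hs₁ hd₁ hs₂
    cases x with
    | infty =>
      rw [smul_infty_eq_self_iff', hφ, hval, map_eq_zero, b10, mul_eq_zero,
        or_iff_right ht₂] at key₂
      exact hs₂ ⟨g₂.val 0 0 - g₂.val 1 1, by rw [key₂]; ring⟩
    | coe x =>
      rw [smul_coe_eq_self_iff] at key₁ key₂
      simp only [hφ, ← map_sub, hval, a01, a10, a11, b01, b10, b11] at key₁ key₂
      simp only [map_mul, mul_assoc, ← mul_add, ← mul_sub, mul_eq_zero, map_eq_zero, ht₁, ht₂,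
        false_or] at key₁ key₂
      obtain ⟨y, rfl⟩ : ∃ y, f y = x := by
        by_cases hc : g₁.val 1 0 = 0
        · have had : g₁.val 1 1 - g₁.val 0 0 ≠ 0 := by
            intro had
            apply hd₁
            rw [hc]
            linear_combination (g₁.val 1 1 - g₁.val 0 0) * had
          refine ⟨g₁.val 0 1 / (g₁.val 1 1 - g₁.val 0 0), ?_⟩
          rw [map_div₀, div_eq_iff ((map_ne_zero f).mpr had)]
          rw [hc, map_zero] at key₁
          linear_combination -key₁
        · obtain ⟨s, hs⟩ := hs₁
          have h2c : 2 * f (g₁.val 1 0) ≠ 0 :=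
            mul_ne_zero (two_ne_zero_galoisField h2) ((map_ne_zero f).mpr hc)
          have hs' := congrArg f hs
          simp only [map_sub, map_mul, map_add, map_pow, map_ofNat] at hs' key₁
          have hfac : (2 * f (g₁.val 1 0) * x + f (g₁.val 1 1) - f (g₁.val 0 0) - f s) *
              (2 * f (g₁.val 1 0) * x + f (g₁.val 1 1) - f (g₁.val 0 0) + f s) = 0 := by
            linear_combination 4 * f (g₁.val 1 0) * key₁ + hs'
          rcases mul_eq_zero.mp hfac with h | h
          · refine ⟨(g₁.val 0 0 - g₁.val 1 1 + s) / (2 * g₁.val 1 0), ?_⟩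
            simp only [map_div₀, map_sub, map_mul, map_add, map_ofNat]
            rw [div_eq_iff h2c]
            linear_combination -h
          · refine ⟨(g₁.val 0 0 - g₁.val 1 1 - s) / (2 * g₁.val 1 0), ?_⟩
            simp only [map_div₀, map_sub, map_mul, map_ofNat]
            rw [div_eq_iff h2c]
            linear_combination -h
      simp only [← map_mul, ← map_pow, ← map_sub, ← map_add, map_eq_zero] at key₂
      refine hs₂ ⟨2 * g₂.val 1 0 * y + g₂.val 1 1 - g₂.val 0 0, ?_⟩
      linear_combination -4 * g₂.val 1 0 * key₂
  · obtain ⟨n, h1, h5, hn⟩ :=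
      hpow ⟨ρ (φ g₃), Subgroup.mem_map_of_mem _ (Subgroup.mem_map_of_mem _ hg₃)⟩
    have hn' : ρ (φ (g₃ ^ n)) = 1 := by
      rw [map_pow, map_pow]
      exact congrArg Subtype.val hn
    rw [← hscal, Units.val_pow_eq_pow_val] at hn'
    exact hu₃ (trace_det_of_pow_isScalarMat (not_isScalarMat_of_disc_ne_zero hd₃) n h1 h5 hn')

theorem exists_ne_zero_not_isSquare_sq_sub_four (hℓ : 7 < ℓ) :
    ∃ t : ZMod ℓ, t ≠ 0 ∧ ¬ IsSquare (t ^ 2 - 4) := by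
  have hn (n : ℕ) (h0 : 0 < n) (h7 : n < 8) : (n : ZMod ℓ) ≠ 0 := by
    rw [Ne, ZMod.natCast_eq_zero_iff]
    exact Nat.not_dvd_of_pos_of_lt h0 (by omega)
  have h2 : (2 : ZMod ℓ) ≠ 0 := by exact_mod_cast hn 2 (by norm_num) (by norm_num)
  have h3 : (3 : ZMod ℓ) ≠ 0 := by exact_mod_cast hn 3 (by norm_num) (by norm_num)
  obtain ⟨e, he⟩ := FiniteField.exists_nonsquare (F := ZMod ℓ) (by
    rw [ringChar.eq (ZMod ℓ) ℓ]; omega)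
  have main (k : ZMod ℓ) (hk : k ≠ 0) (hek : e + k ^ 2 ≠ 0) :
      ∃ t : ZMod ℓ, t ≠ 0 ∧ ¬ IsSquare (t ^ 2 - 4) := by
    have hd : e - k ^ 2 ≠ 0 := fun h => he ⟨k, by linear_combination h⟩
    refine ⟨2 * (e + k ^ 2) / (e - k ^ 2), div_ne_zero (mul_ne_zero h2 hek) hd, ?_⟩
    rintro ⟨r, hr⟩
    refine he ⟨r * (e - k ^ 2) / (4 * k), ?_⟩
    have h4 : (4 : ZMod ℓ) ≠ 0 := by
      rw [show (4 : ZMod ℓ) = 2 * 2 by norm_num]; exact mul_ne_zero h2 h2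
    field_simp at hr ⊢
    linear_combination hr
  by_cases h1 : e + 1 ^ 2 = 0
  · refine main 2 h2 fun h => h3 ?_
    linear_combination h - h1
  · exact main 1 one_ne_zero h1

open Polynomial in
theorem exists_trace_avoiding_small_orders (hℓ : 7 < ℓ) :
    ∃ t : ZMod ℓ, t * (t ^ 2 - 1) * (t ^ 2 - 2) * (t ^ 2 - 4) * (t ^ 4 - 3 * t ^ 2 + 1) ≠ 0 := by
  have hp := (Fact.out : ℓ.Prime)
  by_cases h11 : ℓ = 11
  · subst h11
    refine ⟨5, fun h => ?_⟩
    have h' : ((5 * 24 * 23 * 21 * 551 : ℕ) : ZMod 11) = 0 := by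
      push_cast
      linear_combination h
    rw [ZMod.natCast_eq_zero_iff] at h'
    omega
  have hlt : 11 < ℓ := by
    by_contra! h
    interval_cases ℓ
    all_goals first | exact h11 rfl | exact absurd hp (by norm_num)
  let f : (ZMod ℓ)[X] :=
    X * (X ^ 2 - C 1) * (X ^ 2 - C 2) * (X ^ 2 - C 4) * (X ^ 4 - C 3 * X ^ 2 + C 1)
  have hmonic : f.Monic := by
    simp only [f]; monicity!
  have hdeg : f.natDegree ≤ 11 := by
    simp only [f]; compute_degree
  obtain ⟨t, ht⟩ := f.exists_eval_ne_zero_of_natDegree_lt_card hmonic.ne_zero (by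
    rw [Cardinal.mk_fintype, ZMod.card]
    exact_mod_cast hdeg.trans_lt hlt)
  exact ⟨t, by simpa [f] using ht⟩

theorem exists_mem_trace_det_one (G : Subgroup (GL2 ℓ))
    (hG : ∀ g : GL2 ℓ, (mat g).det = 1 → g ∈ G) (t : ZMod ℓ) :
    ∃ g ∈ G, (mat g).trace = t ∧ (mat g).det = 1 := by
  let g : GL2 ℓ := GeneralLinearGroup.mkOfDetNeZero !![t, -1; 1, 0] (by simp)
  have hdet : (mat g).det = 1 := by
    change (!![t, -1; 1, 0] : Matrix (Fin 2) (Fin 2) (ZMod ℓ)).det = 1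
    simp
  refine ⟨g, hG g hdet, ?_, hdet⟩
  change (!![t, -1; 1, 0] : Matrix (Fin 2) (Fin 2) (ZMod ℓ)).trace = t
  simp [trace_fin_two]

end Main

/-- Let `ℓ > 7` be prime.  A subgroup `G` of `GL₂(ℤ/ℓℤ)` contains `SL₂(ℤ/ℓℤ)` if and
only if it contains elements `g₁, g₂, g₃`, each of nonzero trace, such that:
(1) `tr(g₁)² − 4·det(g₁)` is a nonzero square;
(2) `tr(g₂)² − 4·det(g₂)` is a non-square;
(3) `u := tr(g₃)²·det(g₃)⁻¹` satisfies `u ∉ {1, 2, 4}` and `u² − 3u + 1 ≠ 0`. -/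
theorem stmt17 (ℓ : ℕ) [Fact (Nat.Prime ℓ)] (hℓ : 7 < ℓ)
    (G : Subgroup (GL2 ℓ)) :
    (∀ g : GL2 ℓ, (mat g).det = 1 → g ∈ G) ↔
      (∃ g₁ ∈ G, (mat g₁).trace ≠ 0 ∧
          IsSquare ((mat g₁).trace ^ 2 - 4 * (mat g₁).det) ∧
          (mat g₁).trace ^ 2 - 4 * (mat g₁).det ≠ 0) ∧
      (∃ g₂ ∈ G, (mat g₂).trace ≠ 0 ∧
          ¬ IsSquare ((mat g₂).trace ^ 2 - 4 * (mat g₂).det)) ∧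
      (∃ g₃ ∈ G, (mat g₃).trace ≠ 0 ∧
          (mat g₃).trace ^ 2 * ((mat g₃).det)⁻¹ ∉ ({1, 2, 4} : Set (ZMod ℓ)) ∧
          ((mat g₃).trace ^ 2 * ((mat g₃).det)⁻¹) ^ 2 -
            3 * ((mat g₃).trace ^ 2 * ((mat g₃).det)⁻¹) + 1 ≠ 0) := by
  have hn (n : ℕ) (h0 : 0 < n) (h7 : n < 8) : (n : ZMod ℓ) ≠ 0 := by
    rw [Ne, ZMod.natCast_eq_zero_iff]
    exact Nat.not_dvd_of_pos_of_lt h0 (by omega)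
  have h2 : (2 : ZMod ℓ) ≠ 0 := by exact_mod_cast hn 2 (by norm_num) (by norm_num)
  have h3 : (3 : ZMod ℓ) ≠ 0 := by exact_mod_cast hn 3 (by norm_num) (by norm_num)
  have h5 : (5 : ZMod ℓ) ≠ 0 := by exact_mod_cast hn 5 (by norm_num) (by norm_num)
  constructor
  · intro hG
    refine ⟨?_, ?_, ?_⟩
    · obtain ⟨g, hg, ht, hd⟩ := exists_mem_trace_det_one G hG (5 / 2)
      have hdisc : (5 / 2 : ZMod ℓ) ^ 2 - 4 * 1 = 3 / 2 * (3 / 2) := by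
        field_simp
        norm_num
      refine ⟨g, hg, ?_⟩
      rw [ht, hd, hdisc]
      exact ⟨div_ne_zero h5 h2, ⟨_, rfl⟩, mul_ne_zero (div_ne_zero h3 h2) (div_ne_zero h3 h2)⟩
    · obtain ⟨t, ht0, hts⟩ := exists_ne_zero_not_isSquare_sq_sub_four hℓ
      obtain ⟨g, hg, ht, hd⟩ := exists_mem_trace_det_one G hG t
      refine ⟨g, hg, ?_⟩
      rw [ht, hd, mul_one]
      exact ⟨ht0, hts⟩
    · obtain ⟨t, ht0⟩ := exists_trace_avoiding_small_orders hℓ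
      obtain ⟨g, hg, ht, hd⟩ := exists_mem_trace_det_one G hG t
      simp only [mul_ne_zero_iff, sub_ne_zero] at ht0
      obtain ⟨⟨⟨⟨h₀, h₁⟩, h₂⟩, h₄⟩, h₅⟩ := ht0
      refine ⟨g, hg, ?_⟩
      rw [ht, hd, inv_one, mul_one]
      refine ⟨h₀, by simp [h₁, h₂, h₄], fun h => h₅ (by linear_combination h)⟩
  · rintro ⟨⟨g₁, hg₁, ht₁, hs₁, hd₁⟩, ⟨g₂, hg₂, ht₂, hs₂⟩, ⟨g₃, hg₃, ht₃, hu₃, hv₃⟩⟩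
    have hdet : (mat g₃).det ≠ 0 := g₃.det_ne_zero
    simp only [Set.mem_insert_iff, Set.mem_singleton_iff, not_or, ← div_eq_mul_inv,
      div_eq_iff hdet, ← sub_eq_zero (b := _ * (mat g₃).det)] at hu₃
    obtain ⟨hu1, hu2, hu4⟩ := hu₃
    rw [one_mul] at hu1
    have hu5 : (mat g₃).trace ^ 4 - 3 * (mat g₃).trace ^ 2 * (mat g₃).det + (mat g₃).det ^ 2 ≠ 0 := by
      intro h
      apply hv₃
      field_simp
      linear_combination h
    obtain ⟨g, hg, hgs, hgd⟩ := exists_nonscalar_disc_eq_zero (by omega) G g₁ g₂ g₃ hg₁ hg₂ hg₃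
      ht₁ hs₁ hd₁ ht₂ hs₂ hu4 (mul_ne_zero (mul_ne_zero (mul_ne_zero ht₃ hu1) hu2) hu5)
    exact fun k hk => mem_of_det_eq_one_of_nonscalar_of_nonsquare h2 G g g₂ hg hg₂ hgs hgd hs₂ k hk
end

section
/- Let ℓ be a prime and let G be a subgroup of GL₂(ℤ/ℓℤ). If ℓ = 2, then G = GL₂(ℤ/2ℤ) if and only if G contains elements g₁, g₂ with tr(g₁) = 1 and dim₁(g₂) = 1. If ℓ > 2, then G contains SL₂(ℤ/ℓℤ) if and only if G contains elements g₁, g₂ such that tr(g₁)² − 4·det(g₁) is a non-square in ℤ/ℓℤ, tr(g₂)² − 4·det(g₂) = 0, and dim₁(g₂) = 1. -/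
open Matrix

/-- `dim₁ g`, the dimension of the eigenspace `ker(g − 1)` of `g` acting on `(ℤ/ℓℤ)²`. -/
noncomputable def dimOne {ℓ : ℕ} (g : GL2 ℓ) : ℕ :=
  Module.finrank (ZMod ℓ) (LinearMap.ker (Matrix.toLin' (mat g - 1)))

theorem dimOne_eq_one_iff {ℓ : ℕ} [Fact ℓ.Prime] (g : GL2 ℓ) :
    dimOne g = 1 ↔ (mat g - 1).det = 0 ∧ mat g ≠ 1 := by
  have hle : dimOne g ≤ 2 :=
    (Submodule.finrank_le (LinearMap.ker (Matrix.toLin' (mat g - 1)))).trans_eq (by simp)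
  have h0 : dimOne g = 0 ↔ (mat g - 1).det ≠ 0 := by
    rw [dimOne, Submodule.finrank_eq_zero, Matrix.ker_toLin'_eq_bot_iff, ne_eq,
      ← Matrix.exists_mulVec_eq_zero_iff]
    grind
  have h2 : dimOne g = 2 ↔ mat g = 1 := by
    constructor
    · intro h
      have htop : LinearMap.ker (Matrix.toLin' (mat g - 1)) = ⊤ :=
        Submodule.eq_top_of_finrank_eq (h.trans (by simp))
      rw [LinearMap.ker_eq_top, LinearEquiv.map_eq_zero_iff] at htop
      exact sub_eq_zero.mp htop
    · intro h
      rw [dimOne, h, sub_self, map_zero, LinearMap.ker_zero]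
      simp
  grind

/-- A subgroup of `GL₂(ℤ/ℓℤ)` containing nontrivial upper and lower unipotent matrices contains
`SL₂(ℤ/ℓℤ)`. -/
theorem mem_of_det_eq_one_of_unipotents {ℓ : ℕ} [Fact ℓ.Prime] (H : Subgroup (GL2 ℓ))
    {b c : ZMod ℓ} (hb : b ≠ 0) (hc : c ≠ 0)
    {u l : GL2 ℓ} (hu : u ∈ H) (hl : l ∈ H)
    (hub : mat u = !![1, b; 0, 1]) (hlc : mat l = !![1, 0; c, 1])
    (g : GL2 ℓ) (hg : (mat g).det = 1) : g ∈ H := by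
  have upow (n : ℕ) : mat (u ^ n) = !![1, n * b; 0, 1] := by
    induction n with
    | zero => simp [mat, Matrix.one_fin_two]
    | succ n ih =>
      have : mat (u ^ (n + 1)) = mat (u ^ n) * mat u := by simp [mat, pow_succ]
      rw [this, ih, hub]
      simp [add_mul, add_comm]
  have lpow (n : ℕ) : mat (l ^ n) = !![1, 0; n * c, 1] := by
    induction n with
    | zero => simp [mat, Matrix.one_fin_two]
    | succ n ih =>
      have : mat (l ^ (n + 1)) = mat (l ^ n) * mat l := by simp [mat, pow_succ]
      rw [this, ih, hlc]
      simp [add_mul]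
  have upper (x : ZMod ℓ) : ∃ k ∈ H, mat k = !![1, x; 0, 1] :=
    ⟨u ^ (x / b).val, pow_mem hu _, by rw [upow]; simp [hb]⟩
  have lower (x : ZMod ℓ) : ∃ k ∈ H, mat k = !![1, 0; x, 1] :=
    ⟨l ^ (x / c).val, pow_mem hl _, by rw [lpow]; simp [hc]⟩
  have lower_left_ne_zero (k : GL2 ℓ) (hk : (mat k).det = 1) (h : mat k 1 0 ≠ 0) : k ∈ H := by
    obtain ⟨x, hx, hx'⟩ := upper ((mat k 0 0 - 1) / mat k 1 0)
    obtain ⟨y, hy, hy'⟩ := lower (mat k 1 0)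
    obtain ⟨z, hz, hz'⟩ := upper ((mat k 1 1 - 1) / mat k 1 0)
    have : k = x * y * z := by
      apply Units.ext
      change mat k = mat x * mat y * mat z
      rw [hx', hy', hz']
      rw [Matrix.det_fin_two] at hk
      ext i j
      fin_cases i <;> fin_cases j <;> simp <;> field_simp <;> grind
    rw [this]
    exact mul_mem (mul_mem hx hy) hz
  by_cases h : mat g 1 0 = 0
  · obtain ⟨y, hy, hy'⟩ := lower 1
    have hmul : mat (y * g) = mat y * mat g := rfl
    have hyg : y * g ∈ H := by
      apply lower_left_ne_zero
      · rw [hmul, Matrix.det_mul, hg, hy']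
        simp
      · rw [hmul, hy']
        rw [Matrix.det_fin_two] at hg
        simp [Matrix.mul_apply, h]
        grind
    exact (Subgroup.mul_mem_cancel_left H hy).mp hyg
  · exact lower_left_ne_zero g hg h

/-- A subgroup of `GL₂(ℤ/ℓℤ)` containing an element without eigenvectors and a transvection
contains `SL₂(ℤ/ℓℤ)`. -/
theorem mem_of_det_eq_one_of_transvection {ℓ : ℕ} [Fact ℓ.Prime] (G : Subgroup (GL2 ℓ))
    {g₁ g₂ : GL2 ℓ} (hg₁ : g₁ ∈ G) (hg₂ : g₂ ∈ G)
    (hirr : ∀ v : Fin 2 → ZMod ℓ, v ≠ 0 →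
      v 0 * (mat g₁ *ᵥ v) 1 - v 1 * (mat g₁ *ᵥ v) 0 ≠ 0)
    (hdet : (mat g₂).det = 1) (hdim : dimOne g₂ = 1)
    (g : GL2 ℓ) (hg : (mat g).det = 1) : g ∈ G := by
  obtain ⟨hker, hne⟩ := (dimOne_eq_one_iff g₂).mp hdim
  obtain ⟨v, hv, hvker⟩ := Matrix.exists_mulVec_eq_zero_iff.mpr hker
  have hfix : mat g₂ *ᵥ v = v := by
    rwa [Matrix.sub_mulVec, Matrix.one_mulVec, sub_eq_zero] at hvker
  let w := mat g₁ *ᵥ v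
  let P : GL2 ℓ := Matrix.GeneralLinearGroup.mkOfDetNeZero !![v 0, w 0; v 1, w 1] (by
    have := hirr v hv
    rw [Matrix.det_fin_two_of]
    grind)
  have hP : mat P = !![v 0, w 0; v 1, w 1] := rfl
  have hPv : mat P *ᵥ ![1, 0] = v := by
    rw [hP]; ext i; fin_cases i <;> simp [Matrix.mulVec, dotProduct]
  have hPw : mat P *ᵥ ![0, 1] = w := by
    rw [hP]; ext i; fin_cases i <;> simp [Matrix.mulVec, dotProduct]
  have mat_mul (x y : GL2 ℓ) : mat (x * y) = mat x * mat y := rfl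
  have inv_mulVec {x : GL2 ℓ} {a b : Fin 2 → ZMod ℓ} (h : mat x *ᵥ a = b) :
      mat x⁻¹ *ᵥ b = a := by
    have hx : mat x⁻¹ * mat x = 1 := by
      rw [← mat_mul, inv_mul_cancel]; rfl
    rw [← h, Matrix.mulVec_mulVec, hx, Matrix.one_mulVec]
  have det_conj (x y : GL2 ℓ) : (mat (x * y * x⁻¹)).det = (mat y).det := by
    have hx : (mat x).det * (mat x⁻¹).det = 1 := by
      rw [← Matrix.det_mul, ← mat_mul, mul_inv_cancel]
      exact Matrix.det_one
    rw [mat_mul, mat_mul, Matrix.det_mul, Matrix.det_mul]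
    linear_combination (mat y).det * hx
  have conj_ne {x y : GL2 ℓ} (h : mat y ≠ 1) : mat (x * y * x⁻¹) ≠ 1 := by
    intro h'
    apply h
    have h'' : x * y * x⁻¹ = 1 := Units.ext h'
    rw [conj_eq_one_iff.mp h'']
    rfl
  let H := G.comap (MulAut.conj P).toMonoidHom
  have memH {x : GL2 ℓ} (hx : x ∈ G) : P⁻¹ * x * P⁻¹⁻¹ ∈ H := by
    simpa [H, mul_assoc] using hx
  let u := P⁻¹ * g₂ * P⁻¹⁻¹
  let l := P⁻¹ * (g₁ * g₂ * g₁⁻¹) * P⁻¹⁻¹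
  have hudet : (mat u).det = 1 := by rw [det_conj, hdet]
  have hldet : (mat l).det = 1 := by rw [det_conj, det_conj, hdet]
  have hufix : mat u *ᵥ ![1, 0] = ![1, 0] := by
    simp only [u, inv_inv, mat_mul, ← Matrix.mulVec_mulVec, hPv, hfix, inv_mulVec hPv]
  have hlfix : mat l *ᵥ ![0, 1] = ![0, 1] := by
    have hw : mat g₁⁻¹ *ᵥ w = v := inv_mulVec rfl
    have hw' : mat g₁ *ᵥ v = w := rfl
    simp only [l, inv_inv, mat_mul, ← Matrix.mulVec_mulVec, hPw, hw, hfix, hw', inv_mulVec hPw]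
  have hu : mat u = !![1, mat u 0 1; 0, 1] := by
    have h0 := congrFun hufix 0
    have h1 := congrFun hufix 1
    simp [Matrix.mulVec, dotProduct] at h0 h1
    rw [Matrix.det_fin_two] at hudet
    ext i j
    fin_cases i <;> fin_cases j <;> simp <;> grind
  have hl : mat l = !![1, 0; mat l 1 0, 1] := by
    have h0 := congrFun hlfix 0
    have h1 := congrFun hlfix 1
    simp [Matrix.mulVec, dotProduct] at h0 h1
    rw [Matrix.det_fin_two] at hldet
    ext i j
    fin_cases i <;> fin_cases j <;> simp <;> grind
  have hb : mat u 0 1 ≠ 0 := by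
    intro h
    rw [h, ← Matrix.one_fin_two] at hu
    exact conj_ne hne hu
  have hc : mat l 1 0 ≠ 0 := by
    intro h
    rw [h, ← Matrix.one_fin_two] at hl
    exact conj_ne (conj_ne hne) hl
  have hmem : P⁻¹ * g * P⁻¹⁻¹ ∈ H :=
    mem_of_det_eq_one_of_unipotents H hb hc (memH hg₂)
      (memH (mul_mem (mul_mem hg₁ hg₂) (inv_mem hg₁))) hu hl _ (by rw [det_conj, hg])
  simpa [H, mul_assoc] using hmem

theorem isSquare_discr_of_eigenvector {K : Type*} [Field K] (A : Matrix (Fin 2) (Fin 2) K)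
    {v : Fin 2 → K} (hv : v ≠ 0) (h : v 0 * (A *ᵥ v) 1 - v 1 * (A *ᵥ v) 0 = 0) :
    IsSquare (A.trace ^ 2 - 4 * A.det) := by
  rw [Matrix.trace_fin_two, Matrix.det_fin_two]
  simp [Matrix.mulVec, dotProduct] at h
  by_cases hy : v 1 = 0
  · have hx : v 0 ≠ 0 := fun hx => hv (by ext i; fin_cases i <;> simp [hx, hy])
    have hc : A 1 0 = 0 := by
      simpa [hx, hy] using h
    exact ⟨A 0 0 - A 1 1, by rw [hc]; ring⟩
  · refine ⟨(2 * A 1 0 * v 0 + (A 1 1 - A 0 0) * v 1) / v 1, ?_⟩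
    field_simp
    linear_combination (-4 * A 1 0) * h

/-- Modulo an odd prime, some element of the form `t ^ 2 - 4` is not a square. -/
theorem exists_not_isSquare_sq_sub_four {ℓ : ℕ} [Fact ℓ.Prime] (hℓ : 2 < ℓ) :
    ∃ t : ZMod ℓ, ¬ IsSquare (t ^ 2 - 4) := by
  by_contra! hsq
  have h2 : (2 : ZMod ℓ) ≠ 0 := Ring.two_ne_zero (by rw [ZMod.ringChar_zmod_n]; lia)
  have h4 : (4 : ZMod ℓ) ≠ 0 := by
    have : (4 : ZMod ℓ) = 2 * 2 := by norm_num
    rw [this]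
    exact mul_ne_zero h2 h2
  have hall (n : ℕ) : IsSquare (-(n * 4) : ZMod ℓ) := by
    induction n with
    | zero => simp
    | succ n ih =>
      obtain ⟨t, ht⟩ := ih
      convert hsq t using 1
      push_cast
      linear_combination ht
  obtain ⟨a, ha⟩ := FiniteField.exists_nonsquare (F := ZMod ℓ) (by rw [ZMod.ringChar_zmod_n]; lia)
  apply ha
  simpa [h4] using hall (-a / 4).val

/-- Let `ℓ` be a prime and `G` a subgroup of `GL₂(ℤ/ℓℤ)`.  If `ℓ = 2` then
`G = GL₂(ℤ/2ℤ)` iff `G` contains `g₁, g₂` with `tr(g₁) = 1` and `dim₁(g₂) = 1`.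
If `ℓ > 2` then `G` contains `SL₂(ℤ/ℓℤ)` iff `G` contains `g₁, g₂` with
`tr(g₁)² − 4·det(g₁)` a non-square, `tr(g₂)² − 4·det(g₂) = 0`, and `dim₁(g₂) = 1`. -/
theorem stmt18 (ℓ : ℕ) [Fact (Nat.Prime ℓ)] (G : Subgroup (GL2 ℓ)) :
    (ℓ = 2 →
      (G = ⊤ ↔
        (∃ g₁ ∈ G, (mat g₁).trace = 1) ∧ (∃ g₂ ∈ G, dimOne g₂ = 1))) ∧
    (2 < ℓ →
      ((∀ g : GL2 ℓ, (mat g).det = 1 → g ∈ G) ↔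
        (∃ g₁ ∈ G, ¬ IsSquare ((mat g₁).trace ^ 2 - 4 * (mat g₁).det)) ∧
        (∃ g₂ ∈ G, (mat g₂).trace ^ 2 - 4 * (mat g₂).det = 0 ∧ dimOne g₂ = 1))) := by
  have hU : (mat (GeneralLinearGroup.mkOfDetNeZero !![(1 : ZMod ℓ), 1; 0, 1] (by simp))) =
      !![1, 1; 0, 1] := rfl
  have hUdim : dimOne (GeneralLinearGroup.mkOfDetNeZero !![(1 : ZMod ℓ), 1; 0, 1]
      (by simp)) = 1 := by
    rw [dimOne_eq_one_iff, hU]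
    refine ⟨by simp [Matrix.det_fin_two], fun h => ?_⟩
    simpa using congrFun (congrFun h 0) 1
  refine ⟨?_, fun hℓ => ⟨fun hSL => ⟨?_, _, hSL _ ?_, ?_, hUdim⟩, ?_⟩⟩
  · have eq_one_of_ne_zero : ∀ d : ZMod 2, d ≠ 0 → d = 1 := by decide
    have form_ne_zero : ∀ a b c d x y : ZMod 2, a + d = 1 → a * d - b * c = 1 → x ≠ 0 ∨ y ≠ 0 →
        x * (c * x + d * y) - y * (a * x + b * y) ≠ 0 := by decide
    rintro rfl
    have det_one (g : GL2 2) : (mat g).det = 1 :=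
      eq_one_of_ne_zero _ ((Matrix.isUnit_iff_isUnit_det _).mp g.isUnit).ne_zero
    refine ⟨?_, ?_⟩
    · rintro rfl
      refine ⟨⟨GeneralLinearGroup.mkOfDetNeZero !![1, 1; 1, 0] (by simp), trivial, ?_⟩,
        _, trivial, hUdim⟩
      change Matrix.trace !![(1 : ZMod 2), 1; 1, 0] = 1
      simp [Matrix.trace_fin_two]
    · rintro ⟨⟨g₁, hg₁, htr⟩, g₂, hg₂, hdim⟩
      refine (Subgroup.eq_top_iff' G).mpr fun g =>
        mem_of_det_eq_one_of_transvection G hg₁ hg₂ (fun v hv => ?_) (det_one g₂) hdim g (det_one g)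
      have hdet := det_one g₁
      have hv' : v 0 ≠ 0 ∨ v 1 ≠ 0 := by
        by_contra! h
        exact hv (by ext i; fin_cases i <;> simp [h])
      rw [Matrix.trace_fin_two] at htr
      rw [Matrix.det_fin_two] at hdet
      simp only [Matrix.mulVec, dotProduct, Fin.sum_univ_two]
      exact form_ne_zero _ _ _ _ _ _ htr hdet hv'
  · obtain ⟨t, ht⟩ := exists_not_isSquare_sq_sub_four hℓ
    let A : GL2 ℓ := GeneralLinearGroup.mkOfDetNeZero !![t, -1; 1, 0] (by simp)
    have hA : mat A = !![t, -1; 1, 0] := rfl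
    refine ⟨A, hSL _ (by simp [hA]), ?_⟩
    simpa [hA, Matrix.trace_fin_two] using ht
  · simp [hU]
  · rw [hU, Matrix.trace_fin_two, Matrix.det_fin_two]
    simp
    norm_num
  · rintro ⟨⟨g₁, hg₁, hsq⟩, g₂, hg₂, hdisc, hdim⟩ g hg
    refine mem_of_det_eq_one_of_transvection G hg₁ hg₂
      (fun v hv h => hsq (isSquare_discr_of_eigenvector _ hv h)) ?_ hdim g hg
    have hker := ((dimOne_eq_one_iff g₂).mp hdim).1
    rw [Matrix.trace_fin_two, Matrix.det_fin_two] at hdisc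
    rw [Matrix.det_fin_two] at hker ⊢
    simp at hker
    have : (mat g₂ 0 0 * mat g₂ 1 1 - mat g₂ 0 1 * mat g₂ 1 0 - 1) ^ 2 = 0 := by
      grind
    exact sub_eq_zero.mp (pow_eq_zero_iff two_ne_zero |>.mp this)
end

section
/- For every positive integer n, Σ_{a|n} Σ_{b|n} gcd(a,b) = ∏_{p prime, p|n} ( Σ_{i=0}^{v_p(n)} (2·(v_p(n) − i) + 1)·pⁱ ), where v_p(n) denotes the p-adic valuation of n, the sums on the left range over all ordered pairs of positive divisors of n, and the product on the right ranges over the prime divisors of n. -/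
theorem Nat.Coprime.sum_divisors_mul_eq_sum_sum {M : Type*} [AddCommMonoid M] {m n : ℕ}
    (hmn : m.Coprime n) (f : ℕ → M) :
    ∑ d ∈ (m * n).divisors, f d = ∑ a ∈ m.divisors, ∑ b ∈ n.divisors, f (a * b) := by
  rw [Nat.divisors_mul, Finset.mul_def, Finset.sum_image hmn.mul_injOn_divisors,
    Finset.sum_product]

theorem Nat.Coprime.gcd_mul_mul {a b c d : ℕ} (had : a.Coprime d) (hbc : b.Coprime c)
    (hcd : c.Coprime d) : Nat.gcd (a * b) (c * d) = Nat.gcd a c * Nat.gcd b d := by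
  rw [hcd.gcd_mul, Nat.Coprime.gcd_mul_right_cancel a hbc, Nat.Coprime.gcd_mul_left_cancel b had]

theorem Nat.Coprime.sum_sum_gcd_divisors_mul {m n : ℕ} (hmn : m.Coprime n) :
    ∑ a ∈ (m * n).divisors, ∑ b ∈ (m * n).divisors, Nat.gcd a b =
      (∑ a ∈ m.divisors, ∑ b ∈ m.divisors, Nat.gcd a b) *
        ∑ a ∈ n.divisors, ∑ b ∈ n.divisors, Nat.gcd a b := by
  simp_rw [hmn.sum_divisors_mul_eq_sum_sum]
  rw [Finset.sum_mul_sum]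
  refine Finset.sum_congr rfl fun a ha => Finset.sum_congr rfl fun b hb => ?_
  rw [Finset.sum_mul_sum]
  refine Finset.sum_congr rfl fun c hc => Finset.sum_congr rfl fun d hd => ?_
  have dvd {x k : ℕ} (h : x ∈ k.divisors) : x ∣ k := Nat.dvd_of_mem_divisors h
  exact Nat.Coprime.gcd_mul_mul (hmn.of_dvd (dvd ha) (dvd hd))
    (hmn.symm.of_dvd (dvd hb) (dvd hc)) (hmn.of_dvd (dvd hc) (dvd hd))

theorem sum_sum_gcd_pow (p k : ℕ) :
    ∑ i ∈ Finset.range (k + 1), ∑ j ∈ Finset.range (k + 1), Nat.gcd (p ^ i) (p ^ j) =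
      ∑ i ∈ Finset.range (k + 1), (2 * (k - i) + 1) * p ^ i := by
  induction k with
  | zero => simp
  | succ k ih =>
    have hrow : ∑ i ∈ Finset.range (k + 1), Nat.gcd (p ^ i) (p ^ (k + 1)) =
        ∑ i ∈ Finset.range (k + 1), p ^ i :=
      Finset.sum_congr rfl fun i hi =>
        Nat.gcd_eq_left (pow_dvd_pow p (Finset.mem_range.mp hi).le)
    have hcoeff : ∑ i ∈ Finset.range (k + 1), (2 * (k + 1 - i) + 1) * p ^ i =
        ∑ i ∈ Finset.range (k + 1), (2 * (k - i) + 1) * p ^ i +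
          2 * ∑ i ∈ Finset.range (k + 1), p ^ i := by
      rw [Finset.mul_sum, ← Finset.sum_add_distrib]
      refine Finset.sum_congr rfl fun i hi => ?_
      rw [Nat.sub_add_comm (Finset.mem_range_succ_iff.mp hi)]
      ring
    have hcol : ∑ j ∈ Finset.range (k + 1), Nat.gcd (p ^ (k + 1)) (p ^ j) =
        ∑ i ∈ Finset.range (k + 1), p ^ i := by
      simp_rw [Nat.gcd_comm (p ^ (k + 1)), hrow]
    rw [Finset.sum_range_succ, Finset.sum_range_succ _ (k + 1), Finset.sum_range_succ _ (k + 1),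
      hcoeff, hcol, ← ih]
    simp_rw [Finset.sum_range_succ _ (k + 1)]
    rw [Finset.sum_add_distrib, hrow, Nat.gcd_self, Nat.sub_self]
    ring

/-- For every positive integer `n`,
`Σ_{a|n} Σ_{b|n} gcd(a,b) = ∏_{p prime, p|n} ( Σ_{i=0}^{v_p(n)} (2·(v_p(n) − i) + 1)·pⁱ )`,
where the sums on the left range over all ordered pairs of positive divisors of `n` and
the product on the right ranges over the prime divisors of `n`. -/
theorem stmt19 (n : ℕ) (hn : 0 < n) :
    ∑ a ∈ n.divisors, ∑ b ∈ n.divisors, Nat.gcd a b =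
      ∏ p ∈ n.primeFactors,
        ∑ i ∈ Finset.range (n.factorization p + 1),
          (2 * (n.factorization p - i) + 1) * p ^ i := by
  rw [Nat.multiplicative_factorization
    (fun m => ∑ a ∈ m.divisors, ∑ b ∈ m.divisors, Nat.gcd a b)
    (fun _ _ h => h.sum_sum_gcd_divisors_mul) (by simp) hn.ne', Finsupp.prod,
    Nat.support_factorization]
  refine Finset.prod_congr rfl fun p hp => ?_
  simp_rw [Nat.sum_divisors_prime_pow (Nat.prime_of_mem_primeFactors hp)]
  exact sum_sum_gcd_pow p _
end
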